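/- arXiv:1804.09418 — 2 statements merged into one kernel-verified Lean document; each statement's English description precedes it below -/
import Mathlib

section
/- Fix a ∈ [0,1), σ > 0, ε ∈ (0,1) and d ∈ (0, d_max). The size M of any (n, M, d, ε) code for the Gauss-Markov source must satisfy M ≥ (r(n, ε)/d)^{n/2}, where r(n, ε) > 0 is determined by P[ Σ_{i=1}^n G_i² < n·r(n, ε)/σ² ] = 1 − ε with G_1, …, G_n i.i.d. standard normal random variables (i.e. n·r(n, ε)/σ² is the (1−ε)-quantile of the χ² distribution with n degrees of freedom). -/
open MeasureTheory ProbabilityTheory Real Filter Matrix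
open scoped NNReal ENNReal

noncomputable section

namespace GM

/-- Law of `n` i.i.d. centered Gaussian random variables with variance `σ²`. -/
def gaussPi (σ : ℝ) (n : ℕ) : Measure (Fin n → ℝ) :=
  Measure.pi fun _ => gaussianReal 0 ⟨σ ^ 2, sq_nonneg σ⟩

/-- The Gauss-Markov evolution `U_{i+1} = ∑_{j ≤ i} a^(i-j) Z_{j+1}`
(equivalently `U_0 = 0`, `U_i = a U_{i-1} + Z_i`). -/
def evolve (a : ℝ) (n : ℕ) (z : Fin n → ℝ) : Fin n → ℝ :=
  fun i => ∑ j ∈ Finset.Iic i, a ^ ((i : ℕ) - (j : ℕ)) * z j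

/-- Law of the Gauss-Markov source vector `(U_1, …, U_n)`. -/
def sourceLaw (a σ : ℝ) (n : ℕ) : Measure (Fin n → ℝ) :=
  (gaussPi σ n).map (evolve a n)

/-- Mean squared error distortion. -/
def distortion (n : ℕ) (u v : Fin n → ℝ) : ℝ :=
  (1 / (n : ℝ)) * ∑ i, (u i - v i) ^ 2

/-- There exists an `(n, M, d, ε)` excess-distortion code for the Gauss-Markov source. -/
def IsCode (a σ : ℝ) (n M : ℕ) (d ε : ℝ) : Prop :=
  ∃ f : (Fin n → ℝ) → Fin M, ∃ g : Fin M → (Fin n → ℝ),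
    Measurable f ∧
    sourceLaw a σ n {u | d < distortion n u (g (f u))} ≤ ENNReal.ofReal ε

/-- Minimum achievable code size. -/
def Mstar (a σ : ℝ) (n : ℕ) (d ε : ℝ) : ℕ := sInf {M | IsCode a σ n M d ε}

/-- Minimum achievable source coding rate `R(n, d, ε)`. -/
def rate (a σ : ℝ) (n : ℕ) (d ε : ℝ) : ℝ := Real.log (Mstar a σ n d ε) / n

/-- Gaussian tail function `Q`. -/
def gaussQ (t : ℝ) : ℝ := ∫ s in Set.Ioi t, (Real.sqrt (2 * π))⁻¹ * Real.exp (-(s ^ 2) / 2)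

/-- Power spectrum of the Gauss-Markov source. -/
def S (a σ w : ℝ) : ℝ := σ ^ 2 / (1 + a ^ 2 - 2 * a * Real.cos w)

/-- The limiting reverse waterfilling equation relating distortion `d` and water level `θ`. -/
def waterEq (a σ θ d : ℝ) : Prop :=
  d = (1 / (2 * π)) * ∫ w in Set.Icc (-π) π, min θ (S a σ w)

/-- The rate-distortion function `R_U(d)`, parametrized by the water level `θ` matched to `d`. -/
def RU (a σ θ : ℝ) : ℝ :=
  (1 / (2 * π)) * ∫ w in Set.Icc (-π) π, max 0 ((1 / 2) * Real.log (S a σ w / θ))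

/-- The dispersion `V_U(d)`, parametrized by the water level `θ` matched to `d`. -/
def VU (a σ θ : ℝ) : ℝ :=
  (1 / (4 * π)) * ∫ w in Set.Icc (-π) π, min 1 ((S a σ w / θ) ^ 2)

/-- The lower bidiagonal matrix `A` with `1` on the diagonal, `-a` on the first subdiagonal. -/
def Amat (a : ℝ) (n : ℕ) : Matrix (Fin n) (Fin n) ℝ :=
  Matrix.of fun i j => if i = j then 1 else if (i : ℕ) = (j : ℕ) + 1 then -a else 0

/-- `μv` is the nondecreasing enumeration of the eigenvalues (with multiplicity) of the
real symmetric matrix `M`: it is monotone and `M = P D Pᵀ` for some orthogonal `P`. -/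
def IsEigs {n : ℕ} (μv : Fin n → ℝ) (M : Matrix (Fin n) (Fin n) ℝ) : Prop :=
  Monotone μv ∧ ∃ P : Matrix (Fin n) (Fin n) ℝ,
    P * Pᵀ = 1 ∧ Pᵀ * P = 1 ∧ M = P * Matrix.diagonal μv * Pᵀ

/-- The `i`-th entry of `u` (0-based), or `0` if out of range. -/
def entry {n : ℕ} (u : Fin n → ℝ) (i : ℕ) : ℝ := if h : i < n then u ⟨i, h⟩ else 0

/-- Maximum likelihood estimator `â(u) = (∑_{i=1}^{n-1} u_i u_{i+1}) / (∑_{i=1}^{n-1} u_i²)`. -/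
def mle {n : ℕ} (u : Fin n → ℝ) : ℝ :=
  (∑ i ∈ Finset.range (n - 1), entry u i * entry u (i + 1)) /
    ∑ i ∈ Finset.range (n - 1), entry u i ^ 2

/-- The `d`-tilted information expression, parametrized by a water level `θ`,
per-coordinate variances `sv`, evaluated at the point `x`. -/
def Jtilt {n : ℕ} (θ : ℝ) (sv : Fin n → ℝ) (x : Fin n → ℝ) : ℝ :=
  ∑ i, ((min θ (sv i) / (2 * θ)) * ((x i) ^ 2 / sv i - 1)
        + (1 / 2) * Real.log (max θ (sv i) / θ))

end GM

namespace GM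

def gvar (σ : ℝ) : ℝ≥0 := NNReal.mk (σ ^ 2) (sq_nonneg σ)

lemma coe_gvar (σ : ℝ) : (gvar σ : ℝ) = σ ^ 2 := rfl

lemma gaussPi_eq (σ : ℝ) (n : ℕ) :
    gaussPi σ n = Measure.pi fun _ => gaussianReal 0 (gvar σ) := rfl

instance (σ : ℝ) (n : ℕ) : IsProbabilityMeasure (gaussPi σ n) := by
  rw [gaussPi_eq]; infer_instance

lemma lint_prod : ∀ {n : ℕ} (μ : Fin n → Measure ℝ) [∀ i, SigmaFinite (μ i)]
    (f : Fin n → ℝ → ℝ≥0∞) (_ : ∀ i, Measurable (f i)),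
    ∫⁻ x, ∏ i, f i (x i) ∂(Measure.pi μ) = ∏ i, ∫⁻ t, f i t ∂(μ i) := by
  intro n
  induction n with
  | zero => intro μ _ f hf; simp
  | succ n ih =>
    intro μ _ f hf
    have hm := (measurePreserving_piFinSuccAbove μ 0).symm
    have hmeas : Measurable (fun x : Fin n → ℝ => ∏ i : Fin n, f i.succ (x i)) :=
      Finset.measurable_prod _ (fun i _ => (hf _).comp (measurable_pi_apply i))
    rw [← hm.lintegral_comp_emb (MeasurableEquiv.measurableEmbedding _)]
    simp only [MeasurableEquiv.piFinSuccAbove_symm_apply, Fin.prod_univ_succ, Fin.insertNthEquiv_apply,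
      Fin.insertNth_zero', Fin.cons_zero, Fin.cons_succ, Fin.succAbove_zero]
    rw [lintegral_prod_mul (hf 0).aemeasurable hmeas.aemeasurable,
      ih (fun i => μ i.succ) (fun i => f i.succ) (fun i => hf _)]

lemma gaussPi_density (σ : ℝ) (hσ : 0 < σ) (n : ℕ) :
    gaussPi σ n = (volume : Measure (Fin n → ℝ)).withDensity
      (fun x => ∏ i, gaussianPDF 0 (gvar σ) (x i)) := by
  have hv : gvar σ ≠ 0 := by
    intro h
    have := congrArg NNReal.toReal h
    rw [coe_gvar] at this
    exact (pow_pos hσ 2).ne' this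
  simp only [gaussPi_eq]
  refine Measure.pi_eq fun s hs => ?_
  rw [withDensity_apply _ (MeasurableSet.univ_pi hs), volume_pi, Measure.restrict_pi_pi,
    lint_prod _ _ (fun i => measurable_gaussianPDF _ _)]
  refine Finset.prod_congr rfl fun i _ => ?_
  rw [gaussianReal_apply _ hv]

lemma cmp {n : ℕ} (p : (Fin n → ℝ) → ℝ≥0∞) (c : ℝ≥0∞)
    (hc0 : c ≠ 0) (hc1 : c ≠ ⊤) (B E : Set (Fin n → ℝ)) (hB : MeasurableSet B)
    (hE : MeasurableSet E) (hin : ∀ x ∈ B, c ≤ p x) (hout : ∀ x ∉ B, p x ≤ c)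
    (P : Measure (Fin n → ℝ)) [IsFiniteMeasure P] (hP : P = volume.withDensity p)
    (h : P B ≤ P E) : volume B ≤ volume E := by
  have h1 : P (B \ E) ≤ P (E \ B) := by
    rw [← measure_inter_add_sdiff B hE, ← measure_inter_add_sdiff E hB, Set.inter_comm E B] at h
    exact (ENNReal.add_le_add_iff_left (measure_ne_top _ _)).1 h
  have h2 : c * volume (B \ E) ≤ P (B \ E) := by
    rw [hP, withDensity_apply _ (hB.diff hE), ← setLIntegral_const]
    exact setLIntegral_mono' (hB.diff hE) fun x hx => hin x hx.1
  have h3 : P (E \ B) ≤ c * volume (E \ B) := by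
    rw [hP, withDensity_apply _ (hE.diff hB), ← setLIntegral_const]
    exact setLIntegral_mono' (hE.diff hB) fun x hx => hout x hx.2
  have h4 : volume (B \ E) ≤ volume (E \ B) :=
    (ENNReal.mul_le_mul_iff_right hc0 hc1).1 (h2.trans (h1.trans h3))
  rw [← measure_inter_add_sdiff B hE, ← measure_inter_add_sdiff E hB, Set.inter_comm E B]
  gcongr

def emat (a : ℝ) (n : ℕ) : Matrix (Fin n) (Fin n) ℝ :=
  Matrix.of fun i j => if j ≤ i then a ^ ((i : ℕ) - (j : ℕ)) else 0

lemma evolve_eq (a : ℝ) (n : ℕ) : evolve a n = Matrix.toLin' (emat a n) := by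
  ext z i
  simp only [evolve, emat, Matrix.toLin'_apply, Matrix.mulVec, dotProduct, Matrix.of_apply,
    ite_mul, zero_mul]
  rw [← Finset.sum_filter]
  congr 1
  ext j; simp

lemma emat_det (a : ℝ) (n : ℕ) : (emat a n).det = 1 := by
  rw [Matrix.det_of_isLowerTriangular]
  · simp [emat]
  · intro i j hij
    have : i < j := by simpa using hij
    simp [emat, not_le.2 this]

lemma evolve_mp (a : ℝ) (n : ℕ) : MeasurePreserving (evolve a n) volume volume := by
  rw [evolve_eq]
  refine ⟨(LinearMap.continuous_of_finiteDimensional _).measurable, ?_⟩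
  rw [Real.map_matrix_volume_pi_eq_smul_volume_pi (by rw [emat_det]; exact one_ne_zero), emat_det]
  simp

lemma rpow_half_sum {n : ℕ} (x : Fin n → ℝ) :
    (∑ i, |x i| ^ (2 : ℝ)) ^ (1 / (2 : ℝ)) = √(∑ i, x i ^ 2) := by
  rw [Real.sqrt_eq_rpow]
  simp

lemma vol_balls (n : ℕ) (hn : 0 < n) : ∃ V : ℝ, 0 < V ∧
    (∀ R : ℝ, 0 < R → volume {x : Fin n → ℝ | ∑ i, x i ^ 2 < R} = ENNReal.ofReal (√R ^ n * V)) ∧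
    (∀ R : ℝ, 0 < R → ∀ y : Fin n → ℝ,
      volume {x : Fin n → ℝ | ∑ i, (x i - y i) ^ 2 ≤ R} = ENNReal.ofReal (√R ^ n * V)) := by
  haveI : Nonempty (Fin n) := ⟨⟨0, hn⟩⟩
  refine ⟨(2 * Real.Gamma (1 / 2 + 1)) ^ Fintype.card (Fin n) /
    Real.Gamma (Fintype.card (Fin n) / 2 + 1), ?_, ?_, ?_⟩
  · have h1 : 0 < Real.Gamma (1 / 2 + 1) := Real.Gamma_pos_of_pos (by norm_num)
    have h2 : 0 < Real.Gamma (Fintype.card (Fin n) / 2 + 1) := Real.Gamma_pos_of_pos (by positivity)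
    positivity
  · intro R hR
    have := MeasureTheory.volume_sum_rpow_lt (ι := Fin n) (p := 2) (by norm_num) (√R)
    rw [ENNReal.ofReal_mul (by positivity), ENNReal.ofReal_pow (by positivity)]
    simp only [rpow_half_sum] at this
    rw [Fintype.card_fin] at this ⊢
    rw [← this]
    congr 1
    ext x
    simp only [Set.mem_ofPred_eq]
    rw [Real.sqrt_lt_sqrt_iff (by positivity)]
  · intro R hR y
    have := MeasureTheory.volume_sum_rpow_le (ι := Fin n) (p := 2) (by norm_num) (√R)
    rw [ENNReal.ofReal_mul (by positivity), ENNReal.ofReal_pow (by positivity)]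
    simp only [rpow_half_sum] at this
    rw [Fintype.card_fin] at this ⊢
    rw [← this, ← measure_preimage_add_right volume y]
    congr 1
    ext x
    simp only [Set.mem_ofPred_eq, Set.mem_preimage, Pi.add_apply, add_sub_cancel_right]
    rw [Real.sqrt_le_sqrt_iff hR.le]

lemma pdf_prod (σ : ℝ) (n : ℕ) (x : Fin n → ℝ) :
    ∏ i, gaussianPDF 0 (gvar σ) (x i) =
      ENNReal.ofReal ((√(2 * π * σ ^ 2))⁻¹ ^ n * Real.exp (-(∑ i, x i ^ 2) / (2 * σ ^ 2))) := by
  simp only [gaussianPDF]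
  rw [← ENNReal.ofReal_prod_of_nonneg (fun i _ => gaussianPDFReal_nonneg _ _ _)]
  congr 1
  simp only [gaussianPDFReal, sub_zero, Finset.prod_mul_distrib, Finset.prod_const,
    Finset.card_univ, Fintype.card_fin, coe_gvar]
  rw [← Real.exp_sum, ← Finset.sum_div, Finset.sum_neg_distrib]

lemma gaussPi_ball (σ : ℝ) (hσ : 0 < σ) (n : ℕ) (R : ℝ) :
    gaussPi σ n {x | ∑ i, x i ^ 2 < R} =
      (gaussPi 1 n).map (fun z => ∑ i, z i ^ 2) {x : ℝ | x < R / σ ^ 2} := by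
  have h : gaussPi σ n = (gaussPi 1 n).map (fun z i => σ * z i) := by
    simp only [gaussPi_eq]
    have : SigmaFinite ((gaussianReal 0 (gvar 1)).map (σ * ·)) := by
      rw [gaussianReal_map_const_mul]; infer_instance
    rw [Measure.pi_map_pi (f := fun _ => (σ * ·)) (fun i => by fun_prop)]
    congr 1
    ext1 i
    rw [gaussianReal_map_const_mul]
    congr 1
    · simp
    · ext; simp [coe_gvar]
  rw [h, Measure.map_apply (by fun_prop) (measurableSet_lt (by fun_prop) (by fun_prop)),
    Measure.map_apply (by fun_prop) (measurableSet_lt (by fun_prop) (by fun_prop))]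
  congr 1
  ext z
  simp only [Set.mem_preimage, Set.mem_ofPred_eq, mul_pow, ← Finset.mul_sum]
  rw [lt_div_iff₀ (by positivity), mul_comm]


end GM

theorem stmt11 (a σ ε d : ℝ) (n M : ℕ)
    (ha0 : 0 ≤ a) (ha1 : a < 1) (hσ : 0 < σ)
    (hε : ε ∈ Set.Ioo (0 : ℝ) 1)
    (hd0 : 0 < d) (hdmax : d < σ ^ 2 / (1 - a ^ 2))
    (r : ℝ) (hr : 0 < r)
    (hquant : (GM.gaussPi 1 n).map (fun z => ∑ i, z i ^ 2)
        {x : ℝ | x < n * r / σ ^ 2} = ENNReal.ofReal (1 - ε))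
    (hcode : GM.IsCode a σ n M d ε) :
    (r / d) ^ ((n : ℝ) / 2) ≤ (M : ℝ) := by
  obtain ⟨f, g, -, hfg⟩ := hcode
  rcases Nat.eq_zero_or_pos n with hn | hn
  · subst hn
    have : 0 < M := (Nat.zero_le _).trans_lt (f 0).isLt
    simp only [Nat.cast_zero, zero_div, Real.rpow_zero]
    exact_mod_cast this
  have hn' : (0 : ℝ) < n := by exact_mod_cast hn
  obtain ⟨V, hV, hball, hcball⟩ := GM.vol_balls n hn
  set B : Set (Fin n → ℝ) := {x | ∑ i, x i ^ 2 < n * r} with hBdef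
  set F : Set (Fin n → ℝ) := GM.evolve a n ⁻¹' ⋃ m : Fin M, {u | ∑ i, (u i - g m i) ^ 2 ≤ n * d}
    with hFdef
  have hev := GM.evolve_mp a n
  have hBm : MeasurableSet B := measurableSet_lt (by fun_prop) (by fun_prop)
  have hSm : MeasurableSet (⋃ m : Fin M, {u : Fin n → ℝ | ∑ i, (u i - g m i) ^ 2 ≤ n * d}) :=
    MeasurableSet.iUnion fun m => measurableSet_le (by fun_prop) (by fun_prop)
  have hFm : MeasurableSet F := hev.measurable hSm
  have hPB : GM.gaussPi σ n B = ENNReal.ofReal (1 - ε) := by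
    rw [hBdef, GM.gaussPi_ball σ hσ, hquant]
  have hFc : GM.gaussPi σ n Fᶜ ≤ ENNReal.ofReal ε := by
    refine le_trans ?_ hfg
    refine le_trans (measure_mono ?_) (Measure.le_map_apply hev.measurable.aemeasurable _)
    intro z hz
    simp only [hFdef, Set.mem_compl_iff, Set.mem_preimage, Set.mem_iUnion, Set.mem_ofPred_eq,
      not_exists, not_le] at hz ⊢
    have := hz (f (GM.evolve a n z))
    unfold GM.distortion
    rw [one_div, inv_mul_eq_div, lt_div_iff₀ hn', mul_comm]
    exact this
  have hPF : GM.gaussPi σ n B ≤ GM.gaussPi σ n F := by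
    rw [hPB, ENNReal.ofReal_sub _ hε.1.le, ENNReal.ofReal_one, tsub_le_iff_right]
    calc (1 : ℝ≥0∞) = GM.gaussPi σ n F + GM.gaussPi σ n Fᶜ := by
          rw [measure_add_measure_compl hFm, measure_univ]
      _ ≤ _ := by gcongr
  have hK : 0 < (√(2 * π * σ ^ 2))⁻¹ ^ n := by positivity
  have hvol : volume B ≤ volume F := by
    refine GM.cmp _ (ENNReal.ofReal ((√(2 * π * σ ^ 2))⁻¹ ^ n *
      Real.exp (-(n * r) / (2 * σ ^ 2)))) ?_ ENNReal.ofReal_ne_top B F hBm hFm ?_ ?_ _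
      (GM.gaussPi_density σ hσ n) hPF
    · rw [Ne, ENNReal.ofReal_eq_zero, not_le]
      positivity
    · intro x hx
      rw [GM.pdf_prod]
      have hx' : ∑ i, x i ^ 2 < n * r := hx
      gcongr
    · intro x hx
      rw [GM.pdf_prod]
      have hx' : n * r ≤ ∑ i, x i ^ 2 := not_lt.1 hx
      gcongr
  rw [hball _ (by positivity), hev.measure_preimage hSm.nullMeasurableSet] at hvol
  have h2 : ENNReal.ofReal (√(n * r) ^ n * V) ≤ ENNReal.ofReal (M * (√(n * d) ^ n * V)) := by
    refine hvol.trans ((measure_iUnion_le _).trans ?_)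
    simp only [hcball _ (by positivity : (0 : ℝ) < n * d)]
    rw [tsum_fintype, Finset.sum_const, Finset.card_univ, Fintype.card_fin, nsmul_eq_mul,
      ENNReal.ofReal_mul (Nat.cast_nonneg M), ENNReal.ofReal_natCast]
  rw [ENNReal.ofReal_le_ofReal_iff (by positivity), ← mul_assoc, mul_le_mul_iff_left₀ hV,
    Real.sqrt_mul hn'.le, Real.sqrt_mul hn'.le, mul_pow, mul_pow] at h2
  have h3 : √r ^ n ≤ M * √d ^ n := by
    have : 0 < √(n : ℝ) ^ n := by positivity
    refine le_of_mul_le_mul_left ?_ this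
    linarith
  have h4 : (r / d) ^ ((n : ℝ) / 2) = √r ^ n / √d ^ n := by
    rw [← div_pow, ← Real.sqrt_div hr.le, Real.sqrt_eq_rpow, ← Real.rpow_natCast,
      ← Real.rpow_mul (by positivity)]
    congr 1
    ring
  rw [h4, div_le_iff₀ (by positivity)]
  exact h3

end
end

section
/- Fix a ∈ [0,1), σ > 0 and d ∈ (0, d_max), and let θ > 0 be the unique solution of d = (1/2π)∫_{−π}^{π} min(θ, S(w)) dw. Suppose (d_n) is a sequence in (0, d_max) for which there is a constant h₁ > 0 with |d − d_n| ≤ h₁/n for all sufficiently large n. Then there exists a constant c̃ ∈ (0,1) such that for every u > 2h₁/(c̃θ) and all sufficiently large n: P[ |J_n(X^n, d) − J_n(X^n, d_n)| ≤ u ] ≥ 1 − 1/( n·(c̃θu/(2h₁) − 1)² ), where X^n = (X_1, …, X_n) has independent coordinates X_i ~ N(0, σ_i²). -/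
open MeasureTheory ProbabilityTheory Real Filter Matrix
open scoped NNReal ENNReal

noncomputable section

def gmK : ℝ := Var[fun x : ℝ => x ^ 2; gaussianReal 0 1]

lemma gm_memLp_sq : MemLp (fun x : ℝ => x ^ 2) 2 (gaussianReal 0 1) := by
  have h4 : MemLp (id : ℝ → ℝ) 4 (gaussianReal 0 1) := memLp_id_gaussianReal' 4 (by simp)
  rw [memLp_two_iff_integrable_sq (by fun_prop)]
  have := h4.integrable_norm_pow (p := 4) (by norm_num)
  refine this.congr (Eventually.of_forall fun x => ?_)
  simp only [id]
  rw [Real.norm_eq_abs, ← pow_mul, Even.pow_abs (by decide)]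

lemma gm_map (s : ℝ) (hs : 0 < s) :
    gaussianReal 0 s.toNNReal = (gaussianReal 0 1).map (fun x => √s * x) := by
  rw [gaussianReal_map_const_mul]
  congr 1
  · simp
  · ext
    simp [hs.le]

lemma gm_mp (s : ℝ) (hs : 0 < s) :
    MeasurePreserving (fun x => √s * x) (gaussianReal 0 1) (gaussianReal 0 s.toNNReal) :=
  ⟨by fun_prop, (gm_map s hs).symm⟩

lemma gm_fun (s : ℝ) (hs : 0 < s) (c : ℝ) :
    (fun y : ℝ => c * (y ^ 2 / s - 1)) ∘ (fun x => √s * x) = fun x => c * (x ^ 2 - 1) := by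
  funext x
  simp only [Function.comp]
  rw [mul_pow, Real.sq_sqrt hs.le]
  field_simp

lemma gm_one (c : ℝ) :
    MemLp (fun x : ℝ => c * (x ^ 2 - 1)) 2 (gaussianReal 0 1) ∧
    ∫ x, c * (x ^ 2 - 1) ∂(gaussianReal 0 1) = 0 ∧
    Var[fun x : ℝ => c * (x ^ 2 - 1); gaussianReal 0 1] = c ^ 2 * gmK := by
  refine ⟨(gm_memLp_sq.sub (memLp_const 1)).const_mul c, ?_, ?_⟩
  · rw [integral_const_mul, integral_sub (gm_memLp_sq.integrable (by norm_num)) (by simp)]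
    have h := variance_id_gaussianReal (μ := 0) (v := 1)
    rw [variance_of_integral_eq_zero (by fun_prop) (by simp)] at h
    simp at h
    simp [h]
  · rw [variance_const_mul, variance_sub_const (by fun_prop)]
    rfl

lemma gm_scaled (s : ℝ) (hs : 0 < s) (c : ℝ) :
    MemLp (fun x : ℝ => c * (x ^ 2 / s - 1)) 2 (gaussianReal 0 s.toNNReal) ∧
    ∫ x, c * (x ^ 2 / s - 1) ∂(gaussianReal 0 s.toNNReal) = 0 ∧
    Var[fun x : ℝ => c * (x ^ 2 / s - 1); gaussianReal 0 s.toNNReal] = c ^ 2 * gmK := by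
  obtain ⟨h1, h2, h3⟩ := gm_one c
  refine ⟨?_, ?_, ?_⟩
  · rw [gm_map s hs, memLp_map_measure_iff (by fun_prop) (by fun_prop), gm_fun s hs]
    exact h1
  · rw [gm_map s hs, integral_map (by fun_prop) (by fun_prop)]
    have := gm_fun s hs c
    simp only [funext_iff, Function.comp] at this
    simp_rw [this]
    exact h2
  · rw [gm_map s hs, variance_map (by fun_prop) (by fun_prop), gm_fun s hs]
    exact h3

lemma gm_cheb {n : ℕ} (s : Fin n → ℝ) (hs : ∀ i, 0 < s i) (c : Fin n → ℝ) (g r : ℝ)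
    (hc : ∀ i, |c i| ≤ g) (hr : 0 < r) :
    (Measure.pi fun i : Fin n => gaussianReal 0 (s i).toNNReal)
      {x | r ≤ |∑ i, c i * ((x i) ^ 2 / s i - 1)|} ≤ ENNReal.ofReal (n * (g ^ 2 * gmK) / r ^ 2) := by
  set P := (Measure.pi fun i : Fin n => gaussianReal 0 (s i).toNNReal) with hP
  have hK : 0 ≤ gmK := variance_nonneg _ _
  have hM : ∀ i, MemLp (fun x : Fin n → ℝ => c i * ((x i) ^ 2 / s i - 1)) 2 P := fun i =>
    (gm_scaled (s i) (hs i) (c i)).1.comp_measurePreserving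
      (measurePreserving_eval (fun i : Fin n => gaussianReal 0 (s i).toNNReal) i)
  have hE : ∀ i, ∫ x : Fin n → ℝ, c i * ((x i) ^ 2 / s i - 1) ∂P = 0 := by
    intro i
    have := integral_comp_eval (μ := fun i : Fin n => gaussianReal 0 (s i).toNNReal) (i := i)
      (f := fun x : ℝ => c i * (x ^ 2 / s i - 1)) (by fun_prop)
    rw [hP, this]
    exact (gm_scaled (s i) (hs i) (c i)).2.1
  have hmem : MemLp (∑ i, fun x : Fin n → ℝ => c i * ((x i) ^ 2 / s i - 1)) 2 P :=
    memLp_finsetSum' _ fun i _ => hM i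
  have hE0 : ∫ x, (∑ i, fun x : Fin n → ℝ => c i * ((x i) ^ 2 / s i - 1)) x ∂P = 0 := by
    simp only [Finset.sum_apply]
    rw [integral_finsetSum _ fun i _ => (hM i).integrable (by norm_num)]
    simp [hE]
  have hV : Var[∑ i, fun x : Fin n → ℝ => c i * ((x i) ^ 2 / s i - 1); P] ≤ n * (g ^ 2 * gmK) := by
    rw [hP, variance_sum_pi (X := fun i x => c i * (x ^ 2 / s i - 1))
      fun i => (gm_scaled (s i) (hs i) (c i)).1]
    calc _ ≤ ∑ i : Fin n, g ^ 2 * gmK := by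
          refine Finset.sum_le_sum fun i _ => ?_
          rw [(gm_scaled (s i) (hs i) (c i)).2.2]
          refine mul_le_mul_of_nonneg_right ?_ hK
          exact sq_le_sq' (by linarith [(abs_le.1 (hc i)).1]) (abs_le.1 (hc i)).2
      _ = _ := by simp
  have := meas_ge_le_variance_div_sq hmem hr
  rw [hE0] at this
  simp only [Finset.sum_apply, sub_zero] at this
  refine this.trans (ENNReal.ofReal_le_ofReal ?_)
  gcongr

lemma gm_A {t1 t2 s : ℝ} (h1 : 0 < t1) (h12 : t1 ≤ t2) (hs : 0 < s) :
    |Real.log (max t1 s / t1) - Real.log (max t2 s / t2)| ≤ (min t2 s - min t1 s) / t1 := by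
  have h2 : 0 < t2 := h1.trans_le h12
  rcases le_total s t1 with h | h
  · rw [max_eq_left h, max_eq_left (h.trans h12), min_eq_right h, min_eq_right (h.trans h12)]
    simp [h1.ne', h2.ne']
  have key : ∀ x, t1 ≤ x → |Real.log (x / t1)| ≤ (x - t1) / t1 := by
    intro x hx
    have : 1 ≤ x / t1 := by rwa [le_div_iff₀ h1, one_mul]
    rw [abs_of_nonneg (Real.log_nonneg this)]
    refine (Real.log_le_sub_one_of_pos (by positivity)).trans (le_of_eq ?_)
    field_simp
  rw [max_eq_right h, min_eq_left h]
  rcases le_total s t2 with h' | h'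
  · rw [max_eq_left h', min_eq_right h', div_self h2.ne', Real.log_one, sub_zero]
    exact key s h
  · rw [max_eq_right h', min_eq_left h', ← Real.log_div (by positivity) (by positivity)]
    have : s / t1 / (s / t2) = t2 / t1 := by field_simp
    rw [this]
    exact key t2 h12

lemma gm_B {t1 t2 s : ℝ} (h1 : 0 < t1) (h12 : t1 ≤ t2) (hs : 0 < s) :
    |min t1 s / (2 * t1) - min t2 s / (2 * t2)| ≤ (t2 - t1) / (2 * t1) := by
  have h2 : 0 < t2 := h1.trans_le h12
  rw [div_sub_div _ _ (by positivity) (by positivity), abs_div,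
    abs_of_pos (by positivity : 0 < 2 * t1 * (2 * t2)), div_le_div_iff₀ (by positivity) (by positivity)]
  have : |min t1 s * (2 * t2) - 2 * t1 * min t2 s| ≤ (t2 - t1) * (2 * t2) := by
    rcases le_total s t1 with h | h
    · rw [min_eq_right h, min_eq_right (h.trans h12)]
      rw [abs_le]; constructor <;> nlinarith
    · rw [min_eq_left h]
      rcases le_total s t2 with h' | h'
      · rw [min_eq_right h', abs_le]; constructor <;> nlinarith
      · rw [min_eq_left h', abs_le]; constructor <;> nlinarith
  nlinarith

lemma gm_C {t1 t2 s M : ℝ} (h1 : 0 < t1) (h12 : t1 ≤ t2) (hs : 0 < s) (hM : s ≤ M) :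
    (s - min t2 s) * (t2 - t1) ≤ M * (min t2 s - min t1 s) := by
  rcases le_total s t2 with h | h
  · rw [min_eq_right h]
    have : min t1 s ≤ s := min_le_right _ _
    nlinarith
  · rw [min_eq_left h, min_eq_left (h12.trans h)]
    nlinarith

/-- deterministic core for ordered water levels -/
lemma gm_core {n : ℕ} (hn : 0 < n) (s : Fin n → ℝ) (hs : ∀ i, 0 < s i) {M δ h t1 t2 b D1 D2 : ℝ}
    (hM : ∀ i, s i ≤ M) (hM0 : 0 < M) (hδ : 0 < δ) (hb : 0 < b) (hbt : b ≤ t1) (h12 : t1 ≤ t2)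
    (hD1 : D1 = (1 / (n : ℝ)) * ∑ i, min t1 (s i))
    (hD2 : D2 = (1 / (n : ℝ)) * ∑ i, min t2 (s i))
    (hD : |D1 - D2| ≤ h / n)
    (havg : D2 + δ ≤ (1 / (n : ℝ)) * ∑ i, s i) :
    |∑ i, (1 / 2) * (Real.log (max t1 (s i) / t1) - Real.log (max t2 (s i) / t2))| ≤ h / (2 * b) ∧
    ∀ i, |min t1 (s i) / (2 * t1) - min t2 (s i) / (2 * t2)| ≤ M * h / (2 * b * δ) / n := by
  have hn' : (0 : ℝ) < n := by exact_mod_cast hn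
  have h1 : 0 < t1 := hb.trans_le hbt
  have hsum : ∑ i, (min t2 (s i) - min t1 (s i)) ≤ h := by
    rw [Finset.sum_sub_distrib]
    have h3 := (abs_le.1 hD).1
    have e1 : ∑ i, min t1 (s i) = n * D1 := by rw [hD1]; field_simp
    have e2 : ∑ i, min t2 (s i) = n * D2 := by rw [hD2]; field_simp
    have e3 : h = n * (h / n) := by field_simp
    rw [e1, e2, e3]
    nlinarith
  have hsum0 : 0 ≤ ∑ i, (min t2 (s i) - min t1 (s i)) :=
    Finset.sum_nonneg fun i _ => sub_nonneg.2 (min_le_min_right _ h12)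
  have hh : 0 ≤ h := hsum0.trans hsum
  constructor
  · rw [← Finset.mul_sum, abs_mul, abs_of_pos (by norm_num : (0 : ℝ) < 1 / 2)]
    have : |∑ i, (Real.log (max t1 (s i) / t1) - Real.log (max t2 (s i) / t2))| ≤ h / b := by
      calc _ ≤ ∑ i, |Real.log (max t1 (s i) / t1) - Real.log (max t2 (s i) / t2)| :=
            Finset.abs_sum_le_sum_abs _ _
        _ ≤ ∑ i, (min t2 (s i) - min t1 (s i)) / t1 :=
            Finset.sum_le_sum fun i _ => gm_A h1 h12 (hs i)
        _ = (∑ i, (min t2 (s i) - min t1 (s i))) / t1 := by rw [Finset.sum_div]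
        _ ≤ h / b := by gcongr
    have e : h / (2 * b) = 1 / 2 * (h / b) := by field_simp
    rw [e]
    gcongr
  · intro i
    refine (gm_B h1 h12 (hs i)).trans ?_
    have hC : (n * δ) * (t2 - t1) ≤ M * h := by
      calc (n * δ) * (t2 - t1) ≤ (∑ i, (s i - min t2 (s i))) * (t2 - t1) := by
            refine mul_le_mul_of_nonneg_right ?_ (by linarith)
            rw [Finset.sum_sub_distrib]
            have e2 : ∑ i, min t2 (s i) = n * D2 := by rw [hD2]; field_simp
            have e4 : ∑ i, s i = n * ((1 / (n : ℝ)) * ∑ i, s i) := by field_simp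
            rw [e2, e4]
            nlinarith
        _ = ∑ i, (s i - min t2 (s i)) * (t2 - t1) := by rw [Finset.sum_mul]
        _ ≤ ∑ i, M * (min t2 (s i) - min t1 (s i)) :=
            Finset.sum_le_sum fun i _ => gm_C h1 h12 (hs i) (hM i)
        _ = M * ∑ i, (min t2 (s i) - min t1 (s i)) := by rw [Finset.mul_sum]
        _ ≤ _ := by gcongr
    have e : M * h / (2 * b * δ) / n = (M * h / (n * δ)) / (2 * b) := by field_simp
    rw [e]
    have : t2 - t1 ≤ M * h / (n * δ) := by
      rw [le_div_iff₀ (by positivity)]; linarith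
    have : 0 ≤ t2 - t1 := by linarith
    gcongr

lemma gm_core' {n : ℕ} (hn : 0 < n) (s : Fin n → ℝ) (hs : ∀ i, 0 < s i) {M δ h t1 t2 b D1 D2 : ℝ}
    (hM : ∀ i, s i ≤ M) (hM0 : 0 < M) (hδ : 0 < δ) (hb : 0 < b) (hbt : b ≤ t1) (hbt2 : b ≤ t2)
    (hD1 : D1 = (1 / (n : ℝ)) * ∑ i, min t1 (s i))
    (hD2 : D2 = (1 / (n : ℝ)) * ∑ i, min t2 (s i))
    (hD : |D1 - D2| ≤ h / n)
    (havg1 : D1 + δ ≤ (1 / (n : ℝ)) * ∑ i, s i)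
    (havg : D2 + δ ≤ (1 / (n : ℝ)) * ∑ i, s i) :
    |∑ i, (1 / 2) * (Real.log (max t1 (s i) / t1) - Real.log (max t2 (s i) / t2))| ≤ h / (2 * b) ∧
    ∀ i, |min t1 (s i) / (2 * t1) - min t2 (s i) / (2 * t2)| ≤ M * h / (2 * b * δ) / n := by
  rcases le_total t1 t2 with h12 | h12
  · exact gm_core hn s hs hM hM0 hδ hb hbt h12 hD1 hD2 hD havg
  · obtain ⟨h1, h2⟩ := gm_core hn s hs hM hM0 hδ hb hbt2 h12 hD2 hD1 (by rwa [abs_sub_comm]) havg1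
    refine ⟨?_, fun i => by rw [abs_sub_comm]; exact h2 i⟩
    rw [← abs_neg, ← Finset.sum_neg_distrib]
    convert h1 using 3
    ring_nf

lemma gm_Amul_zero (a : ℝ) (m : ℕ) (p : Fin (m + 1) → ℝ) :
    (GM.Amat a (m + 1) *ᵥ p) 0 = p 0 := by
  simp only [Matrix.mulVec, dotProduct, GM.Amat, Matrix.of_apply]
  rw [Finset.sum_eq_single 0]
  · simp
  · intro j _ hj
    simp [hj.symm]
  · simp

lemma gm_Amul_succ (a : ℝ) (m : ℕ) (p : Fin (m + 1) → ℝ) (i : Fin m) :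
    (GM.Amat a (m + 1) *ᵥ p) i.succ = p i.succ - a * p i.castSucc := by
  simp only [Matrix.mulVec, dotProduct, GM.Amat, Matrix.of_apply]
  have hne : i.succ ≠ i.castSucc := by simp [Fin.ext_iff]
  rw [Finset.sum_eq_add (i.succ) (i.castSucc) hne]
  · simp [hne]; ring
  · rintro j _ ⟨h1, h2⟩
    rw [if_neg (Ne.symm h1), if_neg, zero_mul]
    intro h
    apply h2
    ext
    simp at h ⊢
    omega
  · simp
  · simp

lemma gm_lower (a : ℝ) (ha0 : 0 ≤ a) (ha1 : a < 1) (n : ℕ) (p : Fin n → ℝ) :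
    (1 - a) ^ 2 * ∑ i, p i ^ 2 ≤ ∑ i, (GM.Amat a n *ᵥ p) i ^ 2 := by
  cases n with
  | zero => simp
  | succ m =>
    rw [Fin.sum_univ_succ (fun i => (GM.Amat a (m + 1) *ᵥ p) i ^ 2), gm_Amul_zero]
    simp_rw [gm_Amul_succ]
    have h1 : ∑ i : Fin m, ((1 - a) * p i.succ ^ 2 - a * (1 - a) * p i.castSucc ^ 2) ≤
        ∑ i : Fin m, (p i.succ - a * p i.castSucc) ^ 2 := by
      refine Finset.sum_le_sum fun i _ => ?_
      nlinarith [mul_nonneg ha0 (sq_nonneg (p i.succ - p i.castSucc))]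
    rw [Finset.sum_sub_distrib, ← Finset.mul_sum, ← Finset.mul_sum] at h1
    have e1 := Fin.sum_univ_succ (fun i => p i ^ 2)
    have e2 := Fin.sum_univ_castSucc (fun i => p i ^ 2)
    set X := ∑ i, p i ^ 2
    have q : 0 ≤ a * (1 - a) * p (Fin.last m) ^ 2 := by
      have : 0 ≤ 1 - a := by linarith
      positivity
    have q2 : 0 ≤ a * p 0 ^ 2 := by positivity
    nlinarith

def gmB (a : ℝ) (n : ℕ) : Matrix (Fin n) (Fin n) ℝ :=
  Matrix.of fun i j => if (j : ℕ) ≤ i then a ^ ((i : ℕ) - (j : ℕ)) else 0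

lemma gm_AB (a : ℝ) (n : ℕ) : GM.Amat a n * gmB a n = 1 := by
  cases n with
  | zero => ext i; exact i.elim0
  | succ m =>
    ext i j
    have : (GM.Amat a (m + 1) * gmB a (m + 1)) i j
        = (GM.Amat a (m + 1) *ᵥ (fun k => gmB a (m + 1) k j)) i := rfl
    rw [this]
    refine Fin.cases ?_ (fun i => ?_) i
    · rw [gm_Amul_zero]
      by_cases h : j = 0
      · subst h; simp [gmB]
      · rw [Matrix.one_apply_ne (Ne.symm h)]
        have : (j : ℕ) ≠ 0 := fun h' => h (Fin.ext h')
        simp [gmB, h]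
    · rw [gm_Amul_succ]
      simp only [gmB, Matrix.of_apply, Fin.val_succ, Fin.val_castSucc, Matrix.one_apply,
        Fin.ext_iff]
      rcases lt_trichotomy (j : ℕ) ((i : ℕ) + 1) with h | h | h
      · rw [if_pos h.le, if_pos (by omega), if_neg (by omega)]
        have : (i : ℕ) + 1 - j = (i - j) + 1 := by omega
        rw [this]; ring
      · rw [if_pos h.le, if_neg (by omega), if_pos h.symm, h]; simp
      · rw [if_neg (by omega), if_neg (by omega), if_neg (by omega)]; simp

lemma gm_row (a : ℝ) (n : ℕ) (i : Fin n) :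
    ∑ j, gmB a n i j ^ 2 = ∑ k ∈ Finset.range ((i : ℕ) + 1), (a ^ 2) ^ k := by
  have : ∀ j : Fin n, gmB a n i j ^ 2 =
      (fun j : ℕ => if j ≤ (i : ℕ) then (a ^ 2) ^ ((i : ℕ) - j) else 0) j := by
    intro j
    simp only [gmB, Matrix.of_apply]
    split_ifs
    · ring
    · simp
  simp_rw [this]
  rw [Fin.sum_univ_eq_sum_range (fun j : ℕ => if j ≤ (i : ℕ) then (a ^ 2) ^ ((i : ℕ) - j) else 0) n,
    ← Finset.sum_filter]
  rw [← Finset.sum_range_reflect]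
  have hf : Finset.filter (fun j => j ≤ (i : ℕ)) (Finset.range n) = Finset.range ((i : ℕ) + 1) := by
    ext j; have := i.2; simp; omega
  rw [hf]
  refine Finset.sum_congr rfl fun j _ => ?_
  congr 1

lemma gm_eig_lower (a : ℝ) (ha0 : 0 ≤ a) (ha1 : a < 1) (n : ℕ) (μ : Fin n → ℝ)
    (h : GM.IsEigs μ ((GM.Amat a n)ᵀ * GM.Amat a n)) (i : Fin n) : (1 - a) ^ 2 ≤ μ i := by
  obtain ⟨-, P, h1, h2, h3⟩ := h
  have hd : Matrix.diagonal μ = (GM.Amat a n * P)ᵀ * (GM.Amat a n * P) := by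
    rw [Matrix.transpose_mul]
    calc Matrix.diagonal μ = (Pᵀ * P) * Matrix.diagonal μ * (Pᵀ * P) := by rw [h2]; simp
      _ = Pᵀ * (P * Matrix.diagonal μ * Pᵀ) * P := by simp only [Matrix.mul_assoc]
      _ = _ := by rw [← h3]; simp only [Matrix.mul_assoc]
  have e1 : μ i = ∑ k, (GM.Amat a n *ᵥ (fun k => P k i)) k ^ 2 := by
    have := congrFun (congrFun hd i) i
    rw [Matrix.diagonal_apply_eq] at this
    rw [this, Matrix.mul_apply]
    refine Finset.sum_congr rfl fun k _ => ?_
    rw [Matrix.transpose_apply, sq]; rfl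
  have e2 : ∑ k, P k i ^ 2 = 1 := by
    have := congrFun (congrFun h2 i) i
    rw [Matrix.one_apply_eq, Matrix.mul_apply] at this
    rw [← this]
    refine Finset.sum_congr rfl fun k _ => ?_
    rw [Matrix.transpose_apply, sq]
  have := gm_lower a ha0 ha1 n (fun k => P k i)
  rw [e2, mul_one] at this
  rw [e1]; exact this

lemma gm_trace (a : ℝ) (n : ℕ) (μ : Fin n → ℝ) (hμ : ∀ i, μ i ≠ 0)
    (h : GM.IsEigs μ ((GM.Amat a n)ᵀ * GM.Amat a n)) :
    ∑ i, (μ i)⁻¹ = ∑ i ∈ Finset.range n, ∑ k ∈ Finset.range (i + 1), (a ^ 2) ^ k := by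
  obtain ⟨-, P, h1, h2, h3⟩ := h
  set A := GM.Amat a n
  set B := gmB a n
  have hAB : A * B = 1 := gm_AB a n
  have hBA : B * A = 1 := mul_eq_one_comm.1 hAB
  have r1 : (Aᵀ * A) * (B * Bᵀ) = 1 := by
    calc _ = Aᵀ * (A * B) * Bᵀ := by simp only [Matrix.mul_assoc]
      _ = (B * A)ᵀ := by rw [hAB, Matrix.mul_one, Matrix.transpose_mul]
      _ = 1 := by rw [hBA, Matrix.transpose_one]
  have r2 : (P * Matrix.diagonal (fun i => (μ i)⁻¹) * Pᵀ) * (Aᵀ * A) = 1 := by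
    rw [h3]
    calc _ = P * (Matrix.diagonal (fun i => (μ i)⁻¹) * (Pᵀ * P) * Matrix.diagonal μ) * Pᵀ := by
          simp only [Matrix.mul_assoc]
      _ = P * Pᵀ := by
          rw [h2, Matrix.mul_one, Matrix.diagonal_mul_diagonal]
          simp [hμ]
      _ = 1 := h1
  have r3 : P * Matrix.diagonal (fun i => (μ i)⁻¹) * Pᵀ = B * Bᵀ := left_inv_eq_right_inv r2 r1
  have r4 := congrArg Matrix.trace r3
  rw [Matrix.trace_mul_comm, ← Matrix.mul_assoc, h2, Matrix.one_mul, Matrix.trace_diagonal] at r4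
  rw [r4, ← Fin.sum_univ_eq_sum_range (fun i => ∑ k ∈ Finset.range (i + 1), (a ^ 2) ^ k) n]
  simp only [Matrix.trace, Matrix.diag, Matrix.mul_apply, Matrix.transpose_apply]
  refine Finset.sum_congr rfl fun i _ => ?_
  rw [← gm_row]
  exact Finset.sum_congr rfl fun j _ => (sq _).symm

lemma gm_avg (a σ : ℝ) (ha0 : 0 ≤ a) (ha1 : a < 1) (μv : (n : ℕ) → Fin n → ℝ)
    (hμ : ∀ n, GM.IsEigs (μv n) ((GM.Amat a n)ᵀ * GM.Amat a n)) :
    Tendsto (fun n : ℕ => (1 / (n : ℝ)) * ∑ i, σ ^ 2 / μv n i) atTop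
      (nhds (σ ^ 2 / (1 - a ^ 2))) := by
  have ha2 : a ^ 2 < 1 := by nlinarith
  have h1 : Tendsto (fun i : ℕ => ∑ k ∈ Finset.range (i + 1), (a ^ 2) ^ k) atTop
      (nhds (1 - a ^ 2)⁻¹) :=
    ((hasSum_geometric_of_lt_one (sq_nonneg a) ha2).tendsto_sum_nat).comp (tendsto_add_atTop_nat 1)
  have h2 := h1.cesaro.const_mul (σ ^ 2)
  rw [div_eq_mul_inv]
  refine h2.congr fun n => ?_
  rw [← gm_trace a n (μv n) (fun i => ?_) (hμ n)]
  · simp_rw [div_eq_mul_inv, ← Finset.mul_sum]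
    ring
  · have := gm_eig_lower a ha0 ha1 n (μv n) (hμ n) i
    have h3 : 0 < (1 - a) ^ 2 := by
      have : 0 < 1 - a := by linarith
      positivity
    exact (h3.trans_le this).ne'

set_option maxHeartbeats 2000000 in
theorem stmt13 (a σ d θ : ℝ) (ha0 : 0 ≤ a) (ha1 : a < 1) (hσ : 0 < σ)
    (hd0 : 0 < d) (hdmax : d < σ ^ 2 / (1 - a ^ 2))
    (hθ : 0 < θ) (hwater : GM.waterEq a σ θ d)
    (μv : (n : ℕ) → Fin n → ℝ)
    (hμ : ∀ n, GM.IsEigs (μv n) ((GM.Amat a n)ᵀ * GM.Amat a n))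
    (dn : ℕ → ℝ) (hdn : ∀ n, dn n ∈ Set.Ioo 0 (σ ^ 2 / (1 - a ^ 2)))
    (h₁ : ℝ) (hh₁ : 0 < h₁)
    (hclose : ∀ᶠ n : ℕ in Filter.atTop, |d - dn n| ≤ h₁ / n)
    (θ1 θ2 : ℕ → ℝ)
    (hθ1 : ∀ n, 0 < n → 0 < θ1 n ∧
      d = (1 / (n : ℝ)) * ∑ i : Fin n, min (θ1 n) (σ ^ 2 / μv n i))
    (hθ2 : ∀ n, 0 < n → 0 < θ2 n ∧
      dn n = (1 / (n : ℝ)) * ∑ i : Fin n, min (θ2 n) (σ ^ 2 / μv n i)) :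
    ∃ ctil : ℝ, ctil ∈ Set.Ioo (0 : ℝ) 1 ∧
      ∀ u : ℝ, 2 * h₁ / (ctil * θ) < u →
        ∀ᶠ n : ℕ in Filter.atTop,
          1 - ENNReal.ofReal (1 / (n * (ctil * θ * u / (2 * h₁) - 1) ^ 2)) ≤
            (Measure.pi fun i : Fin n => gaussianReal 0 (σ ^ 2 / μv n i).toNNReal)
              {x | |GM.Jtilt (θ1 n) (fun i => σ ^ 2 / μv n i) x
                    - GM.Jtilt (θ2 n) (fun i => σ ^ 2 / μv n i) x| ≤ u} := by
  have h1a : 0 < 1 - a := by linarith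
  set M : ℝ := σ ^ 2 / (1 - a) ^ 2 with hMdef
  have hM0 : 0 < M := by positivity
  have hμpos : ∀ n i, 0 < μv n i := fun n i =>
    lt_of_lt_of_le (by positivity) (gm_eig_lower a ha0 ha1 n (μv n) (hμ n) i)
  have hspos : ∀ n i, 0 < σ ^ 2 / μv n i := fun n i => div_pos (by positivity) (hμpos n i)
  have hsM : ∀ n i, σ ^ 2 / μv n i ≤ M := by
    intro n i
    rw [hMdef]
    have := gm_eig_lower a ha0 ha1 n (μv n) (hμ n) i
    gcongr
  obtain ⟨δ, hδ, hδd⟩ : ∃ δ : ℝ, 0 < δ ∧ d + 2 * δ < σ ^ 2 / (1 - a ^ 2) :=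
    ⟨(σ ^ 2 / (1 - a ^ 2) - d) / 4, by linarith, by linarith⟩
  have hK : 0 ≤ gmK := variance_nonneg _ _
  set L : ℝ := gmK + 1 with hL
  have hL0 : 0 < L := by linarith
  have hLK : gmK ≤ L ^ 2 := by nlinarith
  set G : ℝ := M * h₁ / (2 * (d / 2) * δ) with hG
  have hG0 : 0 < G := by positivity
  set c : ℝ := min (1 / 2) (min (h₁ / (L * G * θ)) (d / θ)) with hc
  have hc0 : 0 < c := by
    rw [hc]
    refine lt_min (by norm_num) (lt_min (by positivity) (by positivity))
  have hc1 : c ≤ 1 / 2 := min_le_left _ _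
  have hc2 : c * (L * G * θ) ≤ h₁ := by
    rw [← le_div_iff₀ (by positivity)]
    exact (min_le_right _ _).trans (min_le_left _ _)
  have hc3 : c * θ ≤ d := by
    rw [← le_div_iff₀ (by positivity)]
    exact (min_le_right _ _).trans (min_le_right _ _)
  refine ⟨c, ⟨hc0, by linarith⟩, fun u hu => ?_⟩
  have hav := (gm_avg a σ ha0 ha1 μv hμ).eventually (lt_mem_nhds hδd)
  have hlim : Tendsto (fun n : ℕ => h₁ / (n : ℝ)) atTop (nhds 0) :=
    tendsto_const_div_atTop_nhds_zero_nat h₁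
  have hsm1 := hlim.eventually (gt_mem_nhds hδ)
  have hsm2 := hlim.eventually (gt_mem_nhds (half_pos hd0))
  filter_upwards [hav, hsm1, hsm2, hclose, eventually_gt_atTop 0] with n hav hs1 hs2 hcl hn
  have hn' : (0 : ℝ) < n := by exact_mod_cast hn
  obtain ⟨p1, e1⟩ := hθ1 n hn
  obtain ⟨p2, e2⟩ := hθ2 n hn
  have hcl' := abs_le.1 hcl
  have avle : ∀ t : ℝ, (1 / (n : ℝ)) * ∑ i : Fin n, min t (σ ^ 2 / μv n i) ≤ t := by
    intro t
    have : ∑ i : Fin n, min t (σ ^ 2 / μv n i) ≤ ∑ i : Fin n, t :=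
      Finset.sum_le_sum fun i _ => min_le_left _ _
    rw [Finset.sum_const, Finset.card_univ, Fintype.card_fin, nsmul_eq_mul] at this
    rw [one_div, inv_mul_le_iff₀ hn']
    exact this
  have b1 : d / 2 ≤ θ1 n := by
    have := avle (θ1 n)
    rw [← e1] at this
    linarith
  have b2 : d / 2 ≤ θ2 n := by
    have := avle (θ2 n)
    rw [← e2] at this
    linarith [hcl'.2]
  obtain ⟨k1, k2⟩ := gm_core' hn (fun i => σ ^ 2 / μv n i) (hspos n) (hsM n) hM0 hδ (half_pos hd0)
    b1 b2 e1 e2 hcl (by linarith) (by linarith [hcl'.1])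
  set sv : Fin n → ℝ := fun i => σ ^ 2 / μv n i with hsv
  set m := ∑ i, (1 / 2) * (Real.log (max (θ1 n) (sv i) / θ1 n)
    - Real.log (max (θ2 n) (sv i) / θ2 n)) with hm
  set cf : Fin n → ℝ := fun i => min (θ1 n) (sv i) / (2 * θ1 n) - min (θ2 n) (sv i) / (2 * θ2 n)
    with hcf
  have hJ : ∀ x, GM.Jtilt (θ1 n) sv x - GM.Jtilt (θ2 n) sv x
      = ∑ i, cf i * ((x i) ^ 2 / sv i - 1) + m := by
    intro x
    rw [hm, GM.Jtilt, GM.Jtilt, ← Finset.sum_sub_distrib, ← Finset.sum_add_distrib]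
    refine Finset.sum_congr rfl fun i _ => ?_
    simp only [hcf]
    ring
  set v := c * θ * u / (2 * h₁) with hv
  have hv1 : 1 < v := by
    rw [hv, lt_div_iff₀ (by positivity)]
    rw [div_lt_iff₀ (by positivity)] at hu
    linarith
  have hm' : |m| ≤ h₁ / d := by
    have : h₁ / (2 * (d / 2)) = h₁ / d := by congr 1; ring
    rw [← this]; exact k1
  have hkey : L * G * v ≤ u - |m| := by
    have huv : u = 2 * h₁ * v / (c * θ) := by rw [hv]; field_simp
    have i1 : L * G * v ≤ h₁ * v / (c * θ) := by
      rw [le_div_iff₀ (by positivity)]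
      nlinarith
    have i2 : h₁ / d ≤ h₁ * v / (c * θ) := by
      rw [div_le_div_iff₀ (by positivity) (by positivity), mul_assoc]
      refine mul_le_mul_of_nonneg_left ?_ hh₁.le
      nlinarith
    have i3 : 2 * h₁ * v / (c * θ) = h₁ * v / (c * θ) + h₁ * v / (c * θ) := by ring
    rw [huv, i3]
    linarith
  have hLG : 0 < L * G := by positivity
  have hr : 0 < u - |m| := lt_of_lt_of_le (by positivity) hkey
  have hch := gm_cheb sv (hspos n) cf (G / n) (u - |m|) k2 hr
  set P := (Measure.pi fun i : Fin n => gaussianReal 0 (sv i).toNNReal) with hP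
  have hbound : n * ((G / n) ^ 2 * gmK) / (u - |m|) ^ 2 ≤ 1 / (n * (v - 1) ^ 2) := by
    have hv0 : 0 < v - 1 := by linarith
    rw [div_le_div_iff₀ (by positivity) (by positivity)]
    have j1 : (L * G * (v - 1)) ^ 2 ≤ (u - |m|) ^ 2 := by
      refine pow_le_pow_left₀ (by positivity) ?_ 2
      nlinarith
    have j2 : n * ((G / n) ^ 2 * gmK) * (n * (v - 1) ^ 2) = gmK * (G * (v - 1)) ^ 2 := by
      field_simp
    rw [j2, one_mul]
    refine le_trans ?_ j1
    have : (L * G * (v - 1)) ^ 2 = L ^ 2 * (G * (v - 1)) ^ 2 := by ring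
    rw [this]
    gcongr
  have hch' := hch.trans (ENNReal.ofReal_le_ofReal hbound)
  set T := {x : Fin n → ℝ | u - |m| ≤ |∑ i, cf i * ((x i) ^ 2 / sv i - 1)|} with hT
  have hTm : MeasurableSet T := by
    rw [hT]
    refine measurableSet_le (by fun_prop) (by fun_prop)
  have hsub : Tᶜ ⊆ {x | |GM.Jtilt (θ1 n) sv x - GM.Jtilt (θ2 n) sv x| ≤ u} := by
    intro x hx
    simp only [hT, Set.mem_compl_iff, Set.mem_setOf_eq, not_le] at hx
    simp only [Set.mem_setOf_eq]
    rw [hJ x]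
    refine (abs_add_le _ _).trans ?_
    linarith
  refine le_trans ?_ (measure_mono hsub)
  rw [prob_compl_eq_one_sub hTm]
  exact tsub_le_tsub_left hch' 1

end
end
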